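/- arXiv:1501.00251 — 4 statements merged into one kernel-verified Lean document; each statement's English description precedes it below -/
import Mathlib

section
/- Let β > 0, γ ∈ ℝ and λ ∈ ℂ. Then for every x > 0, d/dx [ x^{γ−1} E_{β,γ}(λ x^β) ] = x^{γ−2} E_{β,γ−1}(λ x^β). In particular, with γ = 2, d/dx [ x E_{β,2}(λ x^β) ] = E_{β,1}(λ x^β). -/
open scoped Real

/-- Two-parameter Mittag-Leffler function (complex argument). -/
noncomputable def mlC (a b : ℝ) (z : ℂ) : ℂ :=
  ∑' k : ℕ, z ^ k / Complex.Gamma (((k : ℝ) * a + b : ℝ) : ℂ)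

/-- Two-parameter Mittag-Leffler function (real argument). -/
noncomputable def mlR (a b : ℝ) (x : ℝ) : ℝ :=
  ∑' k : ℕ, x ^ k / Real.Gamma ((k : ℝ) * a + b)

/-- Wright function (real argument). -/
noncomputable def wrightR (p m : ℝ) (x : ℝ) : ℝ :=
  ∑' k : ℕ, x ^ k / ((k.factorial : ℝ) * Real.Gamma (p * (k : ℝ) + m))

/-- Djrbashian-Caputo fractional derivative of order `g ∈ (0,1)` (real-valued). -/
noncomputable def caputoR (g : ℝ) (f : ℝ → ℝ) (t : ℝ) : ℝ :=
  (1 / Real.Gamma (1 - g)) * ∫ s in (0:ℝ)..t, (t - s) ^ (-g) * deriv f s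

/-- Djrbashian-Caputo fractional derivative of order `b ∈ (1,2)` (complex-valued). -/
noncomputable def caputoC2 (b : ℝ) (f : ℝ → ℂ) (x : ℝ) : ℂ :=
  (1 / Complex.Gamma ((2 - b : ℝ) : ℂ)) *
    ∫ s in (0:ℝ)..x, (((x - s) ^ (1 - b) : ℝ) : ℂ) * deriv (deriv f) s

/-- Riemann–Liouville fractional derivative of order `b ∈ (1,2)` (complex-valued). -/
noncomputable def rlC2 (b : ℝ) (f : ℝ → ℂ) (x : ℝ) : ℂ :=
  deriv (deriv (fun y : ℝ =>
    (1 / Complex.Gamma ((2 - b : ℝ) : ℂ)) *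
      ∫ s in (0:ℝ)..y, (((y - s) ^ (1 - b) : ℝ) : ℂ) * f s)) x

/-- A lower bound for the Gamma function showing that it outgrows every exponential. -/
theorem rpow_mul_exp_neg_le_Gamma {M s : ℝ} (hM : 0 < M) (hs : 1 ≤ s) :
    M ^ (s - 1) * Real.exp (-M) ≤ Real.Gamma s := by
  rw [Real.Gamma_eq_integral (by linarith), ← integral_exp_neg_Ioi M,
    ← MeasureTheory.integral_const_mul]
  have hint := Real.GammaIntegral_convergent (s := s) (by linarith)
  have hsub : Set.Ioi M ⊆ Set.Ioi 0 := Set.Ioi_subset_Ioi hM.le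
  calc ∫ t in Set.Ioi M, M ^ (s - 1) * Real.exp (-t)
      ≤ ∫ t in Set.Ioi M, Real.exp (-t) * t ^ (s - 1) := by
        refine MeasureTheory.setIntegral_mono_on ((integrableOn_exp_neg_Ioi M).const_mul _)
          (hint.mono_set hsub) measurableSet_Ioi fun t ht => ?_
        rw [mul_comm]
        gcongr
        exact le_of_lt ht
    _ ≤ ∫ t in Set.Ioi 0, Real.exp (-t) * t ^ (s - 1) := by
        refine MeasureTheory.setIntegral_mono_set hint ?_ hsub.eventuallyLE
        filter_upwards [MeasureTheory.ae_restrict_mem measurableSet_Ioi] with t ht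
        have : 0 < t := ht
        positivity

/-- The Mittag-Leffler series converges absolutely everywhere. -/
theorem summable_norm_mittagLeffler {a : ℝ} (ha : 0 < a) (b : ℝ) (z : ℂ) :
    Summable fun k : ℕ => ‖z ^ k / Complex.Gamma (((k : ℝ) * a + b : ℝ) : ℂ)‖ := by
  set R : ℝ := 2 * (‖z‖ + 1) with hR
  have hR0 : 0 < R := by positivity
  set M : ℝ := R ^ a⁻¹ with hM
  have hM0 : 0 < M := by positivity
  have hMa : M ^ a = R := Real.rpow_inv_rpow hR0.le ha.ne'
  have hgeo : Summable fun k : ℕ => (M ^ (b - 1) * Real.exp (-M))⁻¹ * (1 / 2 : ℝ) ^ k :=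
    summable_geometric_two.mul_left _
  refine Summable.of_norm_bounded_eventually_nat hgeo ?_
  have htend : Filter.Tendsto (fun k : ℕ => (k : ℝ) * a + b) Filter.atTop Filter.atTop :=
    Filter.tendsto_atTop_add_const_right _ _
      (tendsto_natCast_atTop_atTop.atTop_mul_const ha)
  filter_upwards [htend.eventually_ge_atTop 1] with k hk
  have hΓ := rpow_mul_exp_neg_le_Gamma hM0 hk
  have hsplit : M ^ ((k : ℝ) * a + b - 1) = R ^ k * M ^ (b - 1) := by
    rw [add_sub_assoc, Real.rpow_add hM0, mul_comm (k : ℝ) a, Real.rpow_mul hM0.le, hMa,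
      Real.rpow_natCast]
  rw [hsplit] at hΓ
  rw [norm_norm, norm_div, norm_pow, Complex.Gamma_ofReal, Complex.norm_real, Real.norm_eq_abs,
    abs_of_pos (Real.Gamma_pos_of_pos (by linarith))]
  calc ‖z‖ ^ k / Real.Gamma ((k : ℝ) * a + b)
      ≤ (R / 2) ^ k / (R ^ k * M ^ (b - 1) * Real.exp (-M)) := by
        gcongr
        rw [hR]; linarith
    _ = (M ^ (b - 1) * Real.exp (-M))⁻¹ * (1 / 2 : ℝ) ^ k := by
        rw [div_pow, one_div, inv_pow]
        field_simp

/-- Termwise form of the differentiation formula for the Mittag-Leffler function. -/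
theorem hasDerivAt_mittagLeffler_term (a b : ℝ) (w : ℂ) (k : ℕ) {y : ℝ} (hy : 0 < y) :
    HasDerivAt (fun y : ℝ => ((y ^ (b - 1) : ℝ) : ℂ) *
        ((w * ((y ^ a : ℝ) : ℂ)) ^ k / Complex.Gamma (((k : ℝ) * a + b : ℝ) : ℂ)))
      (((y ^ (b - 2) : ℝ) : ℂ) *
        ((w * ((y ^ a : ℝ) : ℂ)) ^ k / Complex.Gamma (((k : ℝ) * a + (b - 1) : ℝ) : ℂ))) y := by
  have hterm (c d : ℝ) (G : ℂ) {u : ℝ} (hu : 0 < u) (hd : d = k * a + c) :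
      ((u ^ c : ℝ) : ℂ) * ((w * ((u ^ a : ℝ) : ℂ)) ^ k / G) = ((u ^ d : ℝ) : ℂ) * (w ^ k / G) := by
    rw [hd, Real.rpow_add hu, mul_comm (k : ℝ) a, Real.rpow_mul hu.le, Real.rpow_natCast]
    push_cast
    ring
  have hG := Complex.one_div_Gamma_eq_self_mul_one_div_Gamma_add_one
    (((k : ℝ) * a + (b - 1) : ℝ) : ℂ)
  have hs : (((k : ℝ) * a + (b - 1) : ℝ) : ℂ) + 1 = (((k : ℝ) * a + b : ℝ) : ℂ) := by
    push_cast; ring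
  rw [hs] at hG
  have hpow := (Real.hasDerivAt_rpow_const (p := k * a + (b - 1))
    (Or.inl hy.ne')).ofReal_comp.mul_const (w ^ k / Complex.Gamma (((k : ℝ) * a + b : ℝ) : ℂ))
  refine (hpow.congr_of_eventuallyEq ?_).congr_deriv ?_
  · filter_upwards [lt_mem_nhds hy] with u hu
    exact hterm _ _ _ hu rfl
  · rw [hterm (b - 2) (k * a + (b - 1) - 1) _ hy (by ring),
      div_eq_mul_inv (w ^ k) (Complex.Gamma (((k : ℝ) * a + (b - 1) : ℝ) : ℂ)), hG]
    push_cast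
    ring

/-- Differentiation formula `d/dx (x^{γ−1} E_{β,γ}(λ x^β)) = x^{γ−2} E_{β,γ−1}(λ x^β)`. -/
theorem stmt_8 (β γ : ℝ) (hβ : 0 < β) (lam : ℂ) (x : ℝ) (hx : 0 < x) :
    HasDerivAt (fun y : ℝ => ((y ^ (γ - 1) : ℝ) : ℂ) * mlC β γ (lam * ((y ^ β : ℝ) : ℂ)))
      (((x ^ (γ - 2) : ℝ) : ℂ) * mlC β (γ - 1) (lam * ((x ^ β : ℝ) : ℂ))) x := by
  set C : ℝ := (x / 2) ^ (γ - 2) + (2 * x) ^ (γ - 2) with hC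
  have hsum := (summable_norm_mittagLeffler hβ (γ - 1) (lam * (((2 * x) ^ β : ℝ) : ℂ))).mul_left C
  have hxm : x ∈ Set.Ioo (x / 2) (2 * x) := ⟨by linarith, by linarith⟩
  have key := hasDerivAt_tsum_of_isPreconnected hsum isOpen_Ioo isPreconnected_Ioo
    (fun k y hy => hasDerivAt_mittagLeffler_term β γ lam k (y := y) (by linarith [hy.1]))
    (fun k y hy => ?_) hxm
    ((summable_norm_mittagLeffler hβ γ (lam * ((x ^ β : ℝ) : ℂ))).of_norm.mul_left _) hxm
  · simpa only [mlC, tsum_mul_left] using key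
  · obtain ⟨hy1, hy2⟩ := hy
    have hy0 : 0 < y := by linarith
    have hle : y ^ (γ - 2) ≤ C := by
      rcases le_total 0 (γ - 2) with h | h
      · have h1 := Real.rpow_le_rpow hy0.le hy2.le h
        have h2 : 0 ≤ (x / 2) ^ (γ - 2) := by positivity
        linarith
      · have h1 := Real.rpow_le_rpow_of_nonpos (by positivity) hy1.le h
        have h2 : 0 ≤ (2 * x) ^ (γ - 2) := by positivity
        linarith
    simp only [norm_mul, norm_div, norm_pow, Complex.norm_real, Real.norm_eq_abs,
      Real.abs_rpow_of_nonneg hy0.le, Real.abs_rpow_of_nonneg (by positivity : 0 ≤ 2 * x),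
      abs_of_pos hy0, abs_of_pos (by positivity : 0 < 2 * x)]
    gcongr
end

section
/- Let β ∈ (1,2) and λ ∈ ℂ. Then the function u(x) = E_{β,1}(λ x^β) on [0,1] satisfies u(0) = 1, u′(0) = 0, and the fractional ordinary differential equation (D_0^β u)(x) = λ u(x) for all x ∈ (0,1], where D_0^β is the left-sided Djrbashian–Caputo fractional derivative of order β. -/
open scoped Real

/-- The `k`-th term of the series of `y ^ (γ - 1) * E_{β,γ}(lam * y ^ β)`. -/
noncomputable def mlTerm (β γ : ℝ) (lam : ℂ) (k : ℕ) (y : ℝ) : ℂ :=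
  lam ^ k * ((y ^ (k * β + γ - 1) / Real.Gamma (k * β + γ) : ℝ) : ℂ)

theorem factorial_le_Gamma_mul_add {β γ : ℝ} (hβ : 1 ≤ β) (hγ : -1 ≤ γ) (k : ℕ) :
    (k.factorial : ℝ) ≤ Real.Gamma ((k + 4 : ℕ) * β + γ) := by
  have hmul : ((k : ℝ) + 4) * 1 ≤ (k + 4) * β := by gcongr
  have hk : (0 : ℝ) ≤ k := k.cast_nonneg
  have hmono : Real.Gamma ((k + 2 : ℕ) + 1) ≤ Real.Gamma ((k + 4 : ℕ) * β + γ) := by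
    apply Real.Gamma_strictMonoOn_Ici.monotoneOn
    · rw [Set.mem_Ici]; push_cast; linarith
    · rw [Set.mem_Ici]; push_cast; linarith
    · push_cast; linarith
  rw [Real.Gamma_nat_eq_factorial] at hmono
  exact le_trans (by exact_mod_cast Nat.factorial_le (by omega)) hmono

theorem summable_pow_div_abs_Gamma {β γ : ℝ} (hβ : 1 ≤ β) (hγ : -1 ≤ γ) {r : ℝ} (hr : 0 ≤ r) :
    Summable fun k : ℕ => r ^ k / |Real.Gamma (k * β + γ)| := by
  rw [← summable_nat_add_iff 4]
  refine Summable.of_nonneg_of_le (fun k => by positivity) (fun k => ?_)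
    ((Real.summable_pow_div_factorial r).mul_left (r ^ 4))
  have hfac : (0 : ℝ) < k.factorial := by exact_mod_cast k.factorial_pos
  have hle := factorial_le_Gamma_mul_add hβ hγ k
  rw [abs_of_pos (hfac.trans_le hle), pow_add, mul_comm (r ^ k), mul_div_assoc]
  gcongr

theorem norm_mlTerm {β γ y : ℝ} (hy : 0 < y) (lam : ℂ) (k : ℕ) :
    ‖mlTerm β γ lam k y‖ =
      y ^ (γ - 1) * ((‖lam‖ * y ^ β) ^ k / |Real.Gamma (k * β + γ)|) := by
  have hpow : y ^ (k * β + γ - 1) = y ^ (γ - 1) * (y ^ β) ^ k := by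
    rw [← Real.rpow_mul_natCast hy.le, ← Real.rpow_add hy]
    congr 1; ring
  rw [mlTerm, norm_mul, norm_pow, Complex.norm_real, Real.norm_eq_abs, abs_div,
    abs_of_pos (Real.rpow_pos_of_pos hy _), hpow, mul_pow]
  ring

theorem summable_mlTerm {β γ y : ℝ} (hβ : 1 ≤ β) (hγ : -1 ≤ γ) (hy : 0 < y) (lam : ℂ) :
    Summable fun k => mlTerm β γ lam k y := by
  refine Summable.of_norm ?_
  simp_rw [norm_mlTerm hy]
  exact (summable_pow_div_abs_Gamma hβ hγ (by positivity)).mul_left _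

theorem mlC_eq_tsum_mlTerm {β y : ℝ} (hy : 0 < y) (lam : ℂ) :
    mlC β 1 (lam * ((y ^ β : ℝ) : ℂ)) = ∑' k, mlTerm β 1 lam k y := by
  refine tsum_congr fun k => ?_
  rw [mlTerm, Complex.Gamma_ofReal, add_sub_cancel_right, mul_comm (k : ℝ) β,
    Real.rpow_mul_natCast hy.le, mul_pow]
  push_cast
  ring

theorem hasDerivAt_mlTerm {β γ y : ℝ} (hy : 0 < y) (lam : ℂ) (k : ℕ) :
    HasDerivAt (mlTerm β γ lam k) (mlTerm β (γ - 1) lam k y) y := by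
  have hpow := ((Real.hasDerivAt_rpow_const (p := k * β + γ - 1) (Or.inl hy.ne')).div_const
    (Real.Gamma (k * β + γ))).ofReal_comp.const_mul (lam ^ k)
  refine hpow.congr_deriv ?_
  rw [mlTerm]
  congr 2
  rw [← add_sub_assoc]
  generalize hp : k * β + γ - 1 = p
  rw [show k * β + γ = p + 1 by linarith]
  rcases eq_or_ne p 0 with rfl | hp0
  · simp
  · rw [Real.Gamma_add_one hp0, mul_div_mul_left _ _ hp0]

theorem hasDerivAt_tsum_mlTerm {β γ y : ℝ} (hβ : 1 ≤ β) (hγ : 0 ≤ γ) (hγ' : γ ≤ 2) (hy : 0 < y)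
    (lam : ℂ) :
    HasDerivAt (fun s => ∑' k, mlTerm β γ lam k s) (∑' k, mlTerm β (γ - 1) lam k y) y := by
  have hmem : y ∈ Set.Ioo (y / 2) (2 * y) := ⟨by linarith, by linarith⟩
  refine hasDerivAt_tsum_of_isPreconnected
    (u := fun k : ℕ => (y / 2) ^ (γ - 1 - 1) *
      ((‖lam‖ * (2 * y) ^ β) ^ k / |Real.Gamma (k * β + (γ - 1))|))
    ((summable_pow_div_abs_Gamma hβ (by linarith) (by positivity)).mul_left _)
    isOpen_Ioo isPreconnected_Ioo (fun k s hs => hasDerivAt_mlTerm (by linarith [hs.1]) lam k)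
    (fun k s hs => ?_) hmem (summable_mlTerm hβ (by linarith) hy lam) hmem
  have hs0 : 0 < s := by linarith [hs.1]
  rw [norm_mlTerm hs0]
  have hbase : s ^ (γ - 1 - 1) ≤ (y / 2) ^ (γ - 1 - 1) :=
    Real.rpow_le_rpow_of_nonpos (by linarith) hs.1.le (by linarith)
  have htop : s ^ β ≤ (2 * y) ^ β := Real.rpow_le_rpow hs0.le hs.2.le (by linarith)
  gcongr

theorem deriv_deriv_mlC {β s : ℝ} (hβ : 1 ≤ β) (hs : 0 < s) (lam : ℂ) :
    deriv (deriv fun y : ℝ => mlC β 1 (lam * ((y ^ β : ℝ) : ℂ))) s =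
      ∑' k, mlTerm β (-1) lam (k + 1) s := by
  have hfirst : ∀ y : ℝ, 0 < y → deriv (fun y : ℝ => mlC β 1 (lam * ((y ^ β : ℝ) : ℂ))) y =
      ∑' k, mlTerm β 0 lam k y := by
    intro y hy
    have heq : (fun y : ℝ => mlC β 1 (lam * ((y ^ β : ℝ) : ℂ))) =ᶠ[nhds y]
        fun y => ∑' k, mlTerm β 1 lam k y := by
      filter_upwards [Ioi_mem_nhds hy] with z hz using mlC_eq_tsum_mlTerm hz lam
    rw [heq.deriv_eq, (hasDerivAt_tsum_mlTerm hβ zero_le_one one_le_two hy lam).deriv, sub_self]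
  have heq : deriv (fun y : ℝ => mlC β 1 (lam * ((y ^ β : ℝ) : ℂ))) =ᶠ[nhds s]
      fun y => ∑' k, mlTerm β 0 lam k y := by
    filter_upwards [Ioi_mem_nhds hs] with z hz using hfirst z hz
  rw [heq.deriv_eq, (hasDerivAt_tsum_mlTerm hβ le_rfl zero_le_two hs lam).deriv, zero_sub,
    (summable_mlTerm hβ le_rfl hs lam).tsum_eq_zero_add]
  have hGamma : Real.Gamma (-1) = 0 := by simpa using Real.Gamma_neg_nat_eq_zero 1
  simp [mlTerm, hGamma]

theorem integral_sub_rpow_mul_rpow {a b x : ℝ} (ha : 0 < a) (hb : 0 < b) (hx : 0 < x) :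
    ∫ s in (0 : ℝ)..x, (x - s) ^ (b - 1) * s ^ (a - 1) =
      x ^ (a + b - 1) * (Real.Gamma a * Real.Gamma b / Real.Gamma (a + b)) := by
  have hscaled := Complex.betaIntegral_scaled a b hx
  have hbeta := Complex.Gamma_mul_Gamma_eq_betaIntegral (s := a) (t := b) (by simpa) (by simpa)
  have hne : Real.Gamma (a + b) ≠ 0 := (Real.Gamma_pos_of_pos (by linarith)).ne'
  rw [← Complex.ofReal_add, Complex.Gamma_ofReal, Complex.Gamma_ofReal, Complex.Gamma_ofReal]
    at hbeta
  have hval : Complex.betaIntegral a b =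
      ((Real.Gamma a * Real.Gamma b / Real.Gamma (a + b) : ℝ) : ℂ) := by
    push_cast
    rw [eq_div_iff (by exact_mod_cast hne), hbeta, mul_comm]
  apply Complex.ofReal_injective
  rw [← intervalIntegral.integral_ofReal, Complex.ofReal_mul, ← hval,
    Complex.ofReal_cpow hx.le]
  push_cast
  rw [← hscaled]
  refine intervalIntegral.integral_congr fun s hs => ?_
  rw [Set.uIcc_of_le hx.le] at hs
  rw [Complex.ofReal_cpow hs.1, Complex.ofReal_cpow (sub_nonneg.2 hs.2), mul_comm]
  push_cast
  rfl

theorem integrableOn_sub_rpow_mul_rpow {a b x : ℝ} (ha : 0 < a) (hb : 0 < b) (hx : 0 < x) :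
    MeasureTheory.IntegrableOn (fun s => (x - s) ^ (b - 1) * s ^ (a - 1)) (Set.Ioc 0 x) := by
  rw [← intervalIntegrable_iff_integrableOn_Ioc_of_le hx.le]
  apply intervalIntegral.intervalIntegrable_of_integral_ne_zero
  rw [integral_sub_rpow_mul_rpow ha hb hx]
  have := Real.Gamma_pos_of_pos ha
  have := Real.Gamma_pos_of_pos hb
  have := Real.Gamma_pos_of_pos (add_pos ha hb)
  positivity

theorem hasDerivAt_mlC_rpow_zero {β : ℝ} (hβ : 1 < β) (lam : ℂ) :
    HasDerivAt (fun x : ℝ => mlC β 1 (lam * ((x ^ β : ℝ) : ℂ))) 0 0 := by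
  have hdiff : DifferentiableOn ℂ (mlC β 1) (Metric.ball 0 1) := by
    refine Complex.differentiableOn_tsum_of_summable_norm
      (summable_pow_div_abs_Gamma hβ.le (by norm_num : (-1 : ℝ) ≤ 1) zero_le_one)
      (fun k => ((differentiable_id.pow k).div_const _).differentiableOn) Metric.isOpen_ball
      fun k w hw => ?_
    have hw1 : ‖w‖ ≤ 1 := (mem_ball_zero_iff.1 hw).le
    rw [norm_div, norm_pow, Complex.Gamma_ofReal, Complex.norm_real, Real.norm_eq_abs]
    gcongr
  have hE := (hdiff.differentiableAt (Metric.ball_mem_nhds 0 one_pos)).hasDerivAt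
  have hpow := (Real.hasDerivAt_rpow_const (x := 0) (Or.inr hβ.le)).ofReal_comp.const_mul lam
  have hcomp := hE.scomp_of_eq (0 : ℝ) hpow (by simp [Real.zero_rpow (by linarith : β ≠ 0)])
  refine hcomp.congr_deriv ?_
  simp [Real.zero_rpow (by linarith : β - 1 ≠ 0)]

theorem caputoC2_mlC {β x : ℝ} (hβ : β ∈ Set.Ioo (1 : ℝ) 2) (lam : ℂ) (hx : 0 < x) :
    caputoC2 β (fun y : ℝ => mlC β 1 (lam * ((y ^ β : ℝ) : ℂ))) x =
      lam * mlC β 1 (lam * ((x ^ β : ℝ) : ℂ)) := by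
  obtain ⟨h1, h2⟩ := hβ
  set F : ℕ → ℝ → ℂ := fun k s => (((x - s) ^ (1 - β) : ℝ) : ℂ) * mlTerm β (-1) lam (k + 1) s
    with hF
  set c : ℕ → ℂ := fun k => lam ^ (k + 1) / ((Real.Gamma ((k + 1 : ℕ) * β + -1) : ℝ) : ℂ) with hc
  set R : ℕ → ℝ → ℝ := fun k s => (x - s) ^ (2 - β - 1) * s ^ ((k + 1 : ℕ) * β + -1 - 1) with hR
  have hFR : ∀ k s, F k s = c k * ((R k s : ℝ) : ℂ) := by
    intro k s
    simp only [hF, hc, hR, mlTerm, show 2 - β - 1 = 1 - β by ring]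
    push_cast
    ring
  have hpos : ∀ k : ℕ, 0 < (k + 1 : ℕ) * β + -1 := by
    intro k
    have : 0 ≤ (k : ℝ) * β := by positivity
    push_cast
    linarith
  have hRint : ∀ k, MeasureTheory.IntegrableOn (R k) (Set.Ioc 0 x) := fun k =>
    integrableOn_sub_rpow_mul_rpow (hpos k) (by linarith) hx
  have hRval : ∀ k, ∫ s in Set.Ioc 0 x, R k s = x ^ (k * β) *
      (Real.Gamma ((k + 1 : ℕ) * β + -1) * Real.Gamma (2 - β) / Real.Gamma (k * β + 1)) := by
    intro k
    rw [← intervalIntegral.integral_of_le hx.le,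
      integral_sub_rpow_mul_rpow (hpos k) (by linarith) hx]
    have hexp : (k + 1 : ℕ) * β + -1 + (2 - β) = k * β + 1 := by push_cast; ring
    rw [hexp, add_sub_cancel_right]
  have hGamma2 : Real.Gamma (2 - β) ≠ 0 := (Real.Gamma_pos_of_pos (by linarith)).ne'
  have hFval : ∀ k, ∫ s in Set.Ioc 0 x, F k s =
      Real.Gamma (2 - β) * (lam * mlTerm β 1 lam k x) := by
    intro k
    simp_rw [hFR]
    rw [MeasureTheory.integral_const_mul, integral_complex_ofReal, hRval, mlTerm, add_sub_cancel_right]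
    have hne : ((Real.Gamma ((k + 1 : ℕ) * β + -1) : ℝ) : ℂ) ≠ 0 := by
      exact_mod_cast (Real.Gamma_pos_of_pos (hpos k)).ne'
    simp only [hc]
    rw [Complex.ofReal_mul, Complex.ofReal_div, Complex.ofReal_mul, Complex.ofReal_div]
    field_simp
    ring
  have hFnorm : ∀ k, ∫ s in Set.Ioc 0 x, ‖F k s‖ = ‖∫ s in Set.Ioc 0 x, F k s‖ := by
    intro k
    have hR0 : ∀ s ∈ Set.Ioc 0 x, 0 ≤ R k s := fun s hs =>
      mul_nonneg (Real.rpow_nonneg (sub_nonneg.2 hs.2) _) (Real.rpow_nonneg hs.1.le _)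
    have hR0' : 0 ≤ ∫ s in Set.Ioc 0 x, R k s :=
      MeasureTheory.setIntegral_nonneg measurableSet_Ioc hR0
    simp_rw [hFR]
    rw [MeasureTheory.integral_const_mul, integral_complex_ofReal, norm_mul, Complex.norm_real,
      Real.norm_of_nonneg hR0', ← MeasureTheory.integral_const_mul]
    refine MeasureTheory.setIntegral_congr_fun measurableSet_Ioc fun s hs => ?_
    simp only [norm_mul, Complex.norm_real, Real.norm_of_nonneg (hR0 s hs)]
  have hsum : HasSum (fun k => ∫ s in Set.Ioc 0 x, F k s) (∫ s in Set.Ioc 0 x, ∑' k, F k s) := by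
    refine MeasureTheory.hasSum_integral_of_summable_integral_norm (fun k => ?_) ?_
    · rw [funext (hFR k)]
      exact (hRint k).ofReal.const_mul _
    · simp_rw [hFnorm, hFval]
      exact (((summable_mlTerm h1.le (by norm_num) hx lam).mul_left lam).mul_left _).norm
  have hint : ∫ s in (0 : ℝ)..x, (((x - s) ^ (1 - β) : ℝ) : ℂ) *
      deriv (deriv fun y : ℝ => mlC β 1 (lam * ((y ^ β : ℝ) : ℂ))) s =
      ∫ s in Set.Ioc 0 x, ∑' k, F k s := by
    rw [intervalIntegral.integral_of_le hx.le]
    refine MeasureTheory.setIntegral_congr_fun measurableSet_Ioc fun s hs => ?_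
    simp only [hF]
    rw [deriv_deriv_mlC h1.le hs.1, tsum_mul_left]
  rw [caputoC2, hint, ← hsum.tsum_eq, tsum_congr hFval, tsum_mul_left, tsum_mul_left,
    ← mlC_eq_tsum_mlTerm hx, Complex.Gamma_ofReal]
  have : ((Real.Gamma (2 - β) : ℝ) : ℂ) ≠ 0 := by exact_mod_cast hGamma2
  field_simp

/-- `u(x) = E_{β,1}(λ x^β)` solves the Caputo fractional ODE `D_0^β u = λ u`,
`u(0) = 1`, `u′(0) = 0`. -/
theorem stmt_9 (β : ℝ) (hβ : β ∈ Set.Ioo (1:ℝ) 2) (lam : ℂ) :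
    (fun x : ℝ => mlC β 1 (lam * ((x ^ β : ℝ) : ℂ))) 0 = 1 ∧
    deriv (fun x : ℝ => mlC β 1 (lam * ((x ^ β : ℝ) : ℂ))) 0 = 0 ∧
    ∀ x ∈ Set.Ioc (0:ℝ) 1,
      caputoC2 β (fun y : ℝ => mlC β 1 (lam * ((y ^ β : ℝ) : ℂ))) x =
        lam * mlC β 1 (lam * ((x ^ β : ℝ) : ℂ)) := by
  refine ⟨?_, (hasDerivAt_mlC_rpow_zero hβ.1 lam).deriv, fun x hx => caputoC2_mlC hβ lam hx.1⟩
  have hβ0 : β ≠ 0 := by linarith [hβ.1]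
  simp only [Real.zero_rpow hβ0, Complex.ofReal_zero, mul_zero, mlC]
  rw [tsum_eq_single 0 fun k hk => by simp [hk]]
  simp
end

section
/- Let α ∈ (0,1] and T > 0. Define p(t) = cos(2πt/T) and f(t) = (∂_t^α p)(t) (the Djrbashian–Caputo derivative of p of order α; for α = 1, f = p′). Then the x-independent function u(x,t) = p(t) satisfies ∂_t^α u − u_xx = f(t) on (0,1) × (0,T), the initial condition u(x,0) = 1, the homogeneous Neumann boundary conditions u_x(0,t) = u_x(1,t) = 0, and the final-time condition u(x,T) = 1; moreover f is not identically zero on (0,T). Since the pair u ≡ 1, f ≡ 0 satisfies the same equation, initial condition, boundary conditions and final-time data u(x,T) = 1, the time-dependent source component f(t) is not uniquely determined by the final time data u(·,T). -/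
open scoped Real

/-- `p(t) = cos(2πt/T)`. -/
noncomputable def p13 (T t : ℝ) : ℝ := Real.cos (2 * Real.pi * t / T)

/-- Caputo derivative of order `α ∈ (0,1]`, with the order-one case being the usual
derivative. -/
noncomputable def capD (α : ℝ) (f : ℝ → ℝ) (t : ℝ) : ℝ :=
  if α = 1 then deriv f t else caputoR α f t

/-- `f(t) = ∂_t^α p(t)`. -/
noncomputable def f13 (α T t : ℝ) : ℝ := capD α (p13 T) t

/-- The x-independent solution `u(x,t) = cos(2πt/T)`. -/
noncomputable def u13 (T : ℝ) (_x t : ℝ) : ℝ := p13 T t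

theorem hasDerivAt_p13 (T t : ℝ) :
    HasDerivAt (p13 T) (-(2 * Real.pi / T * Real.sin (2 * Real.pi * t / T))) t := by
  have h : HasDerivAt (fun s : ℝ => 2 * Real.pi * s / T) (2 * Real.pi / T) t := by
    simpa using ((hasDerivAt_id t).const_mul (2 * Real.pi)).div_const T
  exact h.cos.congr_deriv (by ring)

theorem deriv_p13 (T : ℝ) :
    deriv (p13 T) = fun t => -(2 * Real.pi / T * Real.sin (2 * Real.pi * t / T)) :=
  funext fun t => (hasDerivAt_p13 T t).deriv

/-- The Caputo derivative is negative at `t` if the derivative is continuous and negative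
on `(0, t)`. -/
theorem caputoR_neg_of_deriv_neg {g t : ℝ} {f : ℝ → ℝ} (hg : g < 1) (ht : 0 < t)
    (hc : Continuous (deriv f)) (hf : ∀ s ∈ Set.Ioo 0 t, deriv f s < 0) :
    caputoR g f t < 0 := by
  have hker : IntervalIntegrable (fun s : ℝ => (t - s) ^ (-g)) MeasureTheory.volume 0 t := by
    have h := (intervalIntegral.intervalIntegrable_rpow' (a := t) (b := 0)
      (r := -g) (by linarith)).comp_sub_left t
    simpa using h
  have hint : 0 < ∫ s in (0:ℝ)..t, -((t - s) ^ (-g) * deriv f s) :=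
    intervalIntegral.intervalIntegral_pos_of_pos_on
      (hker.mul_continuousOn hc.continuousOn).neg
      (fun s hs => neg_pos.mpr <| mul_neg_of_pos_of_neg
        (Real.rpow_pos_of_pos (sub_pos.mpr hs.2) _) (hf s hs)) ht
  rw [intervalIntegral.integral_neg] at hint
  exact mul_neg_of_pos_of_neg (one_div_pos.mpr (Real.Gamma_pos_of_pos (by linarith)))
    (neg_pos.mp hint)

theorem deriv_p13_neg {T s : ℝ} (hT : 0 < T) (hs : s ∈ Set.Ioo 0 (T / 2)) :
    deriv (p13 T) s < 0 := by
  have hpi := Real.pi_pos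
  have h0 : 0 < s := hs.1
  rw [deriv_p13, neg_lt_zero]
  refine mul_pos (by positivity) (Real.sin_pos_of_pos_of_lt_pi (by positivity) ?_)
  rw [div_lt_iff₀ hT]
  nlinarith [hs.2]

theorem f13_neg {α T : ℝ} (hα : α ≤ 1) (hT : 0 < T) {t : ℝ} (ht : t ∈ Set.Ioo 0 (T / 2)) :
    f13 α T t < 0 := by
  unfold f13 capD
  split_ifs with h
  · exact deriv_p13_neg hT ht
  · refine caputoR_neg_of_deriv_neg (lt_of_le_of_ne hα h) ht.1 ?_
      fun s hs => deriv_p13_neg hT ⟨hs.1, hs.2.trans ht.2⟩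
    rw [deriv_p13]
    fun_prop

/-- Nonuniqueness for recovering a time-dependent source from final time data:
`u(x,t) = cos(2πt/T)` with source `f = ∂_t^α cos(2π·/T) ≢ 0` has the same initial,
boundary, and final-time data as the pair `u ≡ 1`, `f ≡ 0`. -/
theorem stmt_13 (α T : ℝ) (hα : α ∈ Set.Ioc (0:ℝ) 1) (hT : 0 < T) :
    (∀ x ∈ Set.Ioo (0:ℝ) 1, ∀ t ∈ Set.Ioo (0:ℝ) T,
      capD α (fun s => u13 T x s) t - deriv (deriv (fun y => u13 T y t)) x = f13 α T t) ∧
    (∀ x : ℝ, u13 T x 0 = 1) ∧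
    (∀ t ∈ Set.Ioo (0:ℝ) T,
      deriv (fun y => u13 T y t) 0 = 0 ∧ deriv (fun y => u13 T y t) 1 = 0) ∧
    (∀ x : ℝ, u13 T x T = 1) ∧
    ¬ (∀ t ∈ Set.Ioo (0:ℝ) T, f13 α T t = 0) ∧
    (∀ x ∈ Set.Ioo (0:ℝ) 1, ∀ t ∈ Set.Ioo (0:ℝ) T,
      capD α (fun _ : ℝ => (1:ℝ)) t - deriv (deriv (fun _ : ℝ => (1:ℝ))) x = 0) := by
  refine ⟨fun x _ t _ => ?_, fun x => ?_, fun t _ => ?_, fun x => ?_, fun h => ?_,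
    fun x _ t _ => ?_⟩
  · simp [u13, f13]
  · simp [u13, p13]
  · simp [u13]
  · simp [u13, p13, hT.ne']
  · exact (f13_neg hα.2 hT (t := T / 4) ⟨by linarith, by linarith⟩).ne
      (h (T / 4) ⟨by linarith, by linarith⟩)
  · simp [capD, caputoR]
end

section
/- Let β ∈ (1,2). Then lim_{t→+∞} ( E_{β,1}(t)² − E_{β,0}(t) E_{β,2}(t) ) · t^{1−1/β} e^{−t^{1/β}} = 1/(β Γ(2−β)); that is, along the positive real axis the combination E_{β,1}(z)² − E_{β,0}(z)E_{β,2}(z), whose growth governs the conditioning of the space-fractional sideways problem with Cauchy data at x = 1, grows like (1/(βΓ(2−β))) z^{1/β−1} e^{z^{1/β}} as |z| → ∞ (the leading e^{2z^{1/β}} terms cancel). -/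
open scoped Real

open Complex Set Filter Topology MeasureTheory

/-- The integral of `F` along the three sides of the half-strip `1 < Re w`, `|Im w| < π`,
the image of a Hankel contour under the logarithm. -/
noncomputable def hankelIntegral (F : ℂ → ℂ) : ℂ :=
  I * (∫ y in (-π)..π, F ((1 : ℝ) + y * I)) +
    ∫ x in Ioi (1 : ℝ), (F (x + π * I) - F (x - π * I))

lemma integrable_exp_neg_mul_exp_mul {s a : ℝ} (hs : 0 < s) (ha : 0 < a) :
    Integrable fun x : ℝ => Real.exp (-(s * Real.exp x)) * Real.exp (a * x) := by
  have h1 : Integrable fun x : ℝ => Real.exp (-(Real.exp x)) * Real.exp (a * x) := by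
    have h := Real.GammaIntegral_convergent ha
    rw [← Real.range_exp, ← image_univ, integrableOn_image_iff_integrableOn_abs_deriv_smul
      MeasurableSet.univ (fun x _ => (Real.hasDerivAt_exp x).hasDerivWithinAt)
      Real.exp_injective.injOn, integrableOn_univ] at h
    refine h.congr (Eventually.of_forall fun x => ?_)
    simp only [abs_of_pos (Real.exp_pos x), smul_eq_mul, ← Real.exp_mul, ← Real.exp_add]
    congr 1
    ring
  refine ((h1.comp_add_right (Real.log s)).const_mul (Real.exp (-(a * Real.log s)))).congr
    (Eventually.of_forall fun x => ?_)
  simp only [Real.exp_add x, Real.exp_log hs, mul_add, Real.exp_add (a * x), Real.exp_neg (a * _)]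
  field_simp

lemma integral_exp_neg_mul_exp_mul {s a : ℝ} (hs : 0 < s) (ha : 0 < a) :
    ∫ x : ℝ, Real.exp (-(s * Real.exp x)) * Real.exp (a * x) = s ^ (-a) * Real.Gamma a := by
  have h := Real.integral_rpow_mul_exp_neg_mul_Ioi ha hs
  rw [← Real.range_exp, ← image_univ, integral_image_eq_integral_abs_deriv_smul
    MeasurableSet.univ (fun x _ => (Real.hasDerivAt_exp x).hasDerivWithinAt)
    Real.exp_injective.injOn, setIntegral_univ] at h
  rw [one_div, Real.inv_rpow hs.le, ← Real.rpow_neg hs.le] at h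
  rw [← h]
  congr 1 with x
  simp only [abs_of_pos (Real.exp_pos x), smul_eq_mul, ← Real.exp_mul, ← Real.exp_add]
  congr 1
  ring

lemma integrableOn_exp_neg_mul_exp_mul {s : ℝ} (hs : 0 < s) (a : ℝ) :
    IntegrableOn (fun x : ℝ => Real.exp (-(s * Real.exp x)) * Real.exp (a * x)) (Ioi 1) := by
  refine Integrable.mono'
    (integrable_exp_neg_mul_exp_mul hs (a := |a| + 1) (by positivity)).integrableOn
    (by fun_prop) ?_
  filter_upwards [ae_restrict_mem measurableSet_Ioi] with x hx
  rw [Real.norm_of_nonneg (by positivity)]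
  have hx : 1 < x := hx
  have := le_abs_self a
  gcongr
  linarith

lemma hankelIntegral_eq_of_tendsto {F : ℂ → ℂ} {L : ℂ}
    (hF : DifferentiableOn ℂ F {w | |w.im| ≤ π})
    (hD : Integrable fun x : ℝ => F (x + π * I) - F (x - π * I))
    (hL : Tendsto (fun x : ℝ => ∫ y in (-π)..π, F (x + y * I)) atBot (𝓝 L)) :
    hankelIntegral F = I * L + ∫ x : ℝ, (F (x + π * I) - F (x - π * I)) := by
  have hc : ∀ c : ℝ, |c| ≤ π → Continuous fun x : ℝ => F (x + c * I) := fun c hc =>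
    hF.continuousOn.comp_continuous (by fun_prop) (fun x => by simpa using hc)
  have hrect : ∀ x₀ : ℝ, I * (∫ y in (-π)..π, F ((1 : ℝ) + y * I)) =
      I * (∫ y in (-π)..π, F (x₀ + y * I)) +
        ∫ x in x₀..1, (F (x + π * I) - F (x - π * I)) := by
    intro x₀
    have h := integral_boundary_rect_eq_zero_of_differentiableOn F ⟨x₀, -π⟩ ⟨1, π⟩
      (hF.mono fun w hw => by
        have h2 : w.im ∈ uIcc (-π) π := hw.2
        rw [uIcc_of_le (neg_le_self Real.pi_pos.le)] at h2
        exact abs_le.2 h2)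
    simp only [smul_eq_mul] at h
    have hs : ∫ x in x₀..1, (F (x + π * I) - F (x - π * I)) =
        (∫ x in x₀..1, F (x + π * I)) - ∫ x in x₀..1, F (x + (-π : ℝ) * I) := by
      rw [← intervalIntegral.integral_sub ((hc π (abs_of_pos Real.pi_pos).le).intervalIntegrable _ _)
        ((hc (-π) (by rw [abs_neg, abs_of_pos Real.pi_pos])).intervalIntegrable _ _)]
      simp [sub_eq_add_neg]
    rw [hs]
    linear_combination h
  have hlim : Tendsto (fun x₀ : ℝ => I * (∫ y in (-π)..π, F (x₀ + y * I)) +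
      ∫ x in x₀..1, (F (x + π * I) - F (x - π * I))) atBot
      (𝓝 (I * L + ∫ x in Iic (1 : ℝ), (F (x + π * I) - F (x - π * I)))) :=
    (hL.const_mul I).add (intervalIntegral_tendsto_integral_Iic 1 hD.integrableOn tendsto_id)
  have heq := tendsto_nhds_unique (hlim.congr fun x => (hrect x).symm) tendsto_const_nhds
  rw [hankelIntegral, ← heq, ← intervalIntegral.integral_Iic_add_Ioi hD.integrableOn
    hD.integrableOn, add_assoc]

lemma exp_add_pi_mul_I_ofReal (x : ℝ) : cexp (x + π * I) = -(Real.exp x : ℂ) := by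
  rw [Complex.exp_add, Complex.exp_pi_mul_I]; simp

lemma exp_sub_pi_mul_I_ofReal (x : ℝ) : cexp (x - π * I) = -(Real.exp x : ℂ) := by
  rw [Complex.exp_sub, Complex.exp_pi_mul_I, div_neg, div_one, ofReal_exp]

lemma exp_mul_exp_add_pi_mul_I (s c x : ℝ) :
    cexp (s * cexp (x + π * I)) * cexp (c * (x + π * I)) =
      cexp (c * π * I) * ((Real.exp (-(s * Real.exp x)) * Real.exp (c * x) : ℝ) : ℂ) := by
  rw [exp_add_pi_mul_I_ofReal, mul_add, Complex.exp_add]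
  push_cast
  ring_nf

lemma exp_mul_exp_sub_pi_mul_I (s c x : ℝ) :
    cexp (s * cexp (x - π * I)) * cexp (c * (x - π * I)) =
      cexp (-(c * π * I)) * ((Real.exp (-(s * Real.exp x)) * Real.exp (c * x) : ℝ) : ℂ) := by
  rw [exp_sub_pi_mul_I_ofReal, mul_sub, sub_eq_add_neg, Complex.exp_add]
  push_cast
  ring_nf

lemma exp_mul_I_sub_exp_neg_mul_I (c : ℝ) :
    cexp (c * π * I) - cexp (-(c * π * I)) = 2 * I * (Real.sin (π * c) : ℝ) := by
  rw [← neg_mul, Complex.exp_mul_I, Complex.exp_mul_I, Complex.cos_neg, Complex.sin_neg]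
  push_cast
  ring_nf

lemma norm_exp_mul_exp_le {s : ℝ} (hs : 0 < s) (c x y : ℝ) :
    ‖cexp (s * cexp (x + y * I)) * cexp (c * (x + y * I))‖ ≤
      Real.exp (s * Real.exp x) * Real.exp (c * x) := by
  rw [norm_mul, Complex.norm_exp, Complex.norm_exp]
  have h : (s * cexp (x + y * I)).re ≤ s * Real.exp x := by
    refine (Complex.re_le_norm _).trans ?_
    simp [Complex.norm_exp, abs_of_pos hs]
  gcongr
  simp

lemma exp_mul_exp_sub {s c x : ℝ} :
    cexp (s * cexp (x + π * I)) * cexp (c * (x + π * I)) -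
      cexp (s * cexp (x - π * I)) * cexp (c * (x - π * I)) =
      2 * I * (Real.sin (π * c) : ℝ) *
        ((Real.exp (-(s * Real.exp x)) * Real.exp (c * x) : ℝ) : ℂ) := by
  rw [exp_mul_exp_add_pi_mul_I, exp_mul_exp_sub_pi_mul_I, ← exp_mul_I_sub_exp_neg_mul_I, sub_mul]

lemma sin_mul_Gamma_one_sub {γ : ℝ} (hγ : γ < 1) :
    Real.sin (π * (1 - γ)) * Real.Gamma (1 - γ) = π * (1 / Real.Gamma γ) := by
  have hsin : Real.sin (π * (1 - γ)) = Real.sin (π * γ) := by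
    rw [mul_sub, mul_one, Real.sin_pi_sub]
  rw [hsin]
  by_cases h : Real.Gamma γ = 0
  · obtain ⟨m, hm⟩ := (Real.Gamma_eq_zero_iff γ).1 h
    rw [h, hm, mul_comm π, neg_mul, Real.sin_neg, Real.sin_nat_mul_pi]
    simp
  · have h1 := Real.Gamma_mul_Gamma_one_sub γ
    have h2 := (Real.Gamma_pos_of_pos (sub_pos.2 hγ)).ne'
    have h3 : Real.sin (π * γ) ≠ 0 := fun h3 => by
      rw [h3, div_zero] at h1
      exact mul_ne_zero h h2 h1
    rw [eq_div_iff h3] at h1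
    rw [mul_one_div, eq_div_iff h]
    linear_combination h1

lemma hankelIntegral_of_lt_one {s γ : ℝ} (hs : 0 < s) (hγ : γ < 1) :
    hankelIntegral (fun w => cexp (s * cexp w) * cexp ((1 - γ : ℝ) * w)) =
      2 * π * I * (s ^ (γ - 1) / Real.Gamma γ : ℝ) := by
  have hc : 0 < 1 - γ := by linarith
  rw [hankelIntegral_eq_of_tendsto (L := 0) (by fun_prop)]
  · simp only [exp_mul_exp_sub]
    rw [integral_const_mul, integral_complex_ofReal, integral_exp_neg_mul_exp_mul hs hc]
    have h := sin_mul_Gamma_one_sub hγ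
    rw [neg_sub, mul_zero, zero_add]
    have h' : ((Real.sin (π * (1 - γ)) : ℝ) : ℂ) * (Real.Gamma (1 - γ) : ℝ) =
      (π * (1 / Real.Gamma γ) : ℝ) := by exact_mod_cast h
    push_cast at h' ⊢
    linear_combination 2 * I * ((s ^ (γ - 1) : ℝ) : ℂ) * h'
  · simp only [exp_mul_exp_sub]
    exact (integrable_exp_neg_mul_exp_mul hs hc).ofReal.const_mul _
  · refine squeeze_zero_norm (fun x =>
      intervalIntegral.norm_integral_le_of_norm_le_const fun y _ => norm_exp_mul_exp_le hs _ x y) ?_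
    have h1 : Tendsto (fun x : ℝ => Real.exp (s * Real.exp x)) atBot (𝓝 (Real.exp (s * 0))) :=
      (Real.tendsto_exp_atBot.const_mul s).rexp
    have h2 : Tendsto (fun x : ℝ => Real.exp ((1 - γ) * x)) atBot (𝓝 0) :=
      Real.tendsto_exp_atBot.comp (tendsto_id.const_mul_atBot hc)
    simpa using (h1.mul h2).mul_const |π - -π|

lemma hankelIntegral_one {s : ℝ} (hs : 0 < s) :
    hankelIntegral (fun w => cexp (s * cexp w)) = 2 * π * I := by
  have hD : ∀ x : ℝ, cexp (s * cexp (x + π * I)) - cexp (s * cexp (x - π * I)) = 0 := fun x => by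
    simp only [exp_add_pi_mul_I_ofReal, exp_sub_pi_mul_I_ofReal, sub_self]
  rw [hankelIntegral_eq_of_tendsto (L := ∫ _ in (-π)..π, 1) (by fun_prop)]
  · simp only [hD, integral_zero, intervalIntegral.integral_const]
    simp
    ring
  · simp only [hD]
    exact integrable_zero _ _ _
  · refine intervalIntegral.tendsto_integral_filter_of_dominated_convergence
      (fun _ => Real.exp (s * Real.exp 0)) ?_ ?_ (by simp) ?_
    · exact Eventually.of_forall fun x => by fun_prop
    · filter_upwards [eventually_le_atBot 0] with x hx
      refine Eventually.of_forall fun y _ => ?_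
      have h := norm_exp_mul_exp_le hs 0 x y
      simp only [ofReal_zero, zero_mul, Complex.exp_zero, mul_one, Real.exp_zero] at h
      refine h.trans ?_
      gcongr
    · refine Eventually.of_forall fun y _ => ?_
      have h1 : Tendsto (fun x : ℝ => cexp (x + y * I)) atBot (𝓝 0) := by
        refine squeeze_zero_norm (a := Real.exp) (fun x => ?_) Real.tendsto_exp_atBot
        simp [Complex.norm_exp]
      simpa using (h1.const_mul (s : ℂ)).cexp

lemma hankelIntegral_deriv_eq_zero {h h' : ℂ → ℂ} (hd : ∀ w, HasDerivAt h (h' w) w)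
    (hc : Continuous h')
    (hi : IntegrableOn (fun x : ℝ => h' (x + π * I) - h' (x - π * I)) (Ioi 1))
    (hl : Tendsto (fun x : ℝ => h (x + π * I) - h (x - π * I)) atTop (𝓝 0)) :
    hankelIntegral h' = 0 := by
  have h1 : ∫ y in (-π)..π, h' ((1 : ℝ) + y * I) * I =
      h ((1 : ℝ) + π * I) - h ((1 : ℝ) + (-π : ℝ) * I) := by
    refine intervalIntegral.integral_eq_sub_of_hasDerivAt
      (f := fun y : ℝ => h ((1 : ℝ) + y * I)) (fun y _ => ?_)
      (Continuous.intervalIntegrable (by fun_prop) _ _)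
    have h2 : HasDerivAt (fun y : ℝ => ((1 : ℝ) : ℂ) + y * I) I y := by
      simpa using ((hasDerivAt_id y).ofReal_comp.mul_const I).const_add ((1 : ℝ) : ℂ)
    exact (hd _).comp y h2
  have h2 : ∫ x in Ioi (1 : ℝ), (h' (x + π * I) - h' (x - π * I)) =
      0 - (h ((1 : ℝ) + π * I) - h ((1 : ℝ) - π * I)) := by
    refine integral_Ioi_of_hasDerivAt_of_tendsto' (f := fun x : ℝ => h (x + π * I) - h (x - π * I))
      (fun x _ => ?_) hi hl
    have h3 : HasDerivAt (fun x : ℝ => (x : ℂ) + π * I) 1 x := by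
      simpa using (hasDerivAt_id x).ofReal_comp.add_const (π * I)
    have h4 : HasDerivAt (fun x : ℝ => (x : ℂ) - π * I) 1 x := by
      simpa using (hasDerivAt_id x).ofReal_comp.sub_const (π * I)
    simpa [Function.comp_def] using! ((hd _).comp x h3).sub ((hd _).comp x h4)
  rw [hankelIntegral, h2, ← intervalIntegral.integral_const_mul]
  simp only [mul_comm I]
  rw [h1]
  push_cast
  ring_nf

lemma hankelIntegral_sub {F G : ℂ → ℂ} (hF : Continuous F) (hG : Continuous G)
    (hF' : IntegrableOn (fun x : ℝ => F (x + π * I) - F (x - π * I)) (Ioi 1))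
    (hG' : IntegrableOn (fun x : ℝ => G (x + π * I) - G (x - π * I)) (Ioi 1)) :
    hankelIntegral (fun w => F w - G w) = hankelIntegral F - hankelIntegral G := by
  have h1 : ∫ x in Ioi (1 : ℝ), (F (x + π * I) - G (x + π * I) - (F (x - π * I) - G (x - π * I))) =
      (∫ x in Ioi (1 : ℝ), (F (x + π * I) - F (x - π * I))) -
        ∫ x in Ioi (1 : ℝ), (G (x + π * I) - G (x - π * I)) := by
    rw [← integral_sub hF' hG']
    congr 1 with x
    ring
  rw [hankelIntegral, h1, intervalIntegral.integral_sub
    (Continuous.intervalIntegrable (by fun_prop) _ _)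
    (Continuous.intervalIntegrable (by fun_prop) _ _), hankelIntegral, hankelIntegral]
  ring

lemma hankelIntegral_const_mul (c : ℂ) (F : ℂ → ℂ) :
    hankelIntegral (fun w => c * F w) = c * hankelIntegral F := by
  simp only [hankelIntegral, ← mul_sub, integral_const_mul, intervalIntegral.integral_const_mul]
  ring

lemma integrableOn_exp_mul_exp_sub {s : ℝ} (hs : 0 < s) (c : ℝ) :
    IntegrableOn (fun x : ℝ => cexp (s * cexp (x + π * I)) * cexp (c * (x + π * I)) -
      cexp (s * cexp (x - π * I)) * cexp (c * (x - π * I))) (Ioi 1) := by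
  simp only [exp_mul_exp_sub]
  exact (integrableOn_exp_neg_mul_exp_mul hs c).ofReal.const_mul _

lemma tendsto_exp_neg_mul_exp_mul_atTop {s : ℝ} (hs : 0 < s) (c : ℝ) :
    Tendsto (fun x : ℝ => Real.exp (-(s * Real.exp x)) * Real.exp (c * x)) atTop (𝓝 0) := by
  have h := (tendsto_rpow_mul_exp_neg_mul_atTop_nhds_zero c s hs).comp Real.tendsto_exp_atTop
  refine h.congr fun x => ?_
  simp only [Function.comp, ← Real.exp_mul]
  rw [mul_comm, mul_comm x, neg_mul]

lemma mul_hankelIntegral_add_one {s μ : ℝ} (hs : 0 < s) :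
    μ * hankelIntegral (fun w => cexp (s * cexp w) * cexp ((1 - (μ + 1) : ℝ) * w)) =
      s * hankelIntegral (fun w => cexp (s * cexp w) * cexp ((1 - μ : ℝ) * w)) := by
  have h := hankelIntegral_deriv_eq_zero (h := fun w => cexp (s * cexp w) * cexp ((-μ : ℝ) * w))
    (h' := fun w => s * (cexp (s * cexp w) * cexp ((1 - μ : ℝ) * w)) -
      μ * (cexp (s * cexp w) * cexp ((1 - (μ + 1) : ℝ) * w))) ?_ (by fun_prop) ?_ ?_
  · rw [hankelIntegral_sub (by fun_prop) (by fun_prop), hankelIntegral_const_mul,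
      hankelIntegral_const_mul] at h
    · linear_combination -h
    · simp only [← mul_sub]
      exact (integrableOn_exp_mul_exp_sub hs _).const_mul _
    · simp only [← mul_sub]
      exact (integrableOn_exp_mul_exp_sub hs _).const_mul _
  · intro w
    have h1 : HasDerivAt (fun w => cexp (s * cexp w)) (cexp (s * cexp w) * (s * cexp w)) w :=
      ((Complex.hasDerivAt_exp w).const_mul (s : ℂ)).cexp
    have h2 : HasDerivAt (fun w => cexp ((-μ : ℝ) * w)) (cexp ((-μ : ℝ) * w) * (-μ : ℝ)) w := by
      simpa using ((hasDerivAt_id w).const_mul ((-μ : ℝ) : ℂ)).cexp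
    refine (h1.mul h2).congr_deriv ?_
    have h3 : cexp ((1 - μ : ℝ) * w) = cexp w * cexp ((-μ : ℝ) * w) := by
      rw [← Complex.exp_add]; push_cast; ring_nf
    rw [h3]
    push_cast
    ring_nf
  · refine (((integrableOn_exp_mul_exp_sub hs (1 - μ)).const_mul (s : ℂ)).sub
      ((integrableOn_exp_mul_exp_sub hs (1 - (μ + 1))).const_mul (μ : ℂ))).congr
      (Eventually.of_forall fun x => ?_)
    simp only [Pi.sub_apply]
    ring
  · simp only [exp_mul_exp_sub]
    have h := (tendsto_exp_neg_mul_exp_mul_atTop hs (-μ)).ofReal.const_mul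
      (2 * I * (Real.sin (π * (-μ)) : ℝ))
    simpa using h

/-- Hankel's formula for the reciprocal of the Gamma function. -/
theorem hankelIntegral_exp_mul_exp {s : ℝ} (hs : 0 < s) (γ : ℝ) :
    hankelIntegral (fun w => cexp (s * cexp w) * cexp ((1 - γ : ℝ) * w)) =
      2 * π * I * (s ^ (γ - 1) / Real.Gamma γ : ℝ) := by
  obtain ⟨n, hn⟩ := exists_nat_ge (γ - 1)
  induction n generalizing γ with
  | zero =>
    rcases (show γ ≤ 1 by simpa using hn).lt_or_eq with h | rfl
    · exact hankelIntegral_of_lt_one hs h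
    · simpa using hankelIntegral_one hs
  | succ n ih =>
    rcases lt_trichotomy γ 1 with h | rfl | h
    · exact hankelIntegral_of_lt_one hs h
    · simpa using hankelIntegral_one hs
    · obtain ⟨μ, rfl⟩ : ∃ μ, γ = μ + 1 := ⟨γ - 1, by ring⟩
      have hμ : μ ≠ 0 := by linarith
      have h1 := mul_hankelIntegral_add_one (μ := μ) hs
      rw [ih μ (by push_cast at hn; linarith)] at h1
      refine mul_left_cancel₀ (ofReal_ne_zero.2 hμ) (h1.trans ?_)
      rw [Real.Gamma_add_one hμ, add_sub_cancel_right, Real.rpow_sub_one hs.ne']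
      have : Real.Gamma μ ≠ 0 := (Real.Gamma_pos_of_pos (by linarith)).ne'
      push_cast
      have h2 : (Real.Gamma μ : ℂ) ≠ 0 := ofReal_ne_zero.2 this
      have h3 : (s : ℂ) ≠ 0 := ofReal_ne_zero.2 hs.ne'
      have h4 := ofReal_ne_zero.2 hμ
      field_simp

/-- The integrand of the contour integral representing the Mittag-Leffler function. -/
noncomputable def mlIntegrand (β γ s : ℝ) (w : ℂ) : ℂ :=
  cexp (s * cexp w) * cexp ((1 - γ : ℝ) * w) / (1 - cexp (-(β * w)))

lemma norm_exp_neg_mul (β x y : ℝ) : ‖cexp (-(β * (x + y * I)))‖ = Real.exp (-(β * x)) := by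
  rw [Complex.norm_exp]; simp

lemma hasSum_mlIntegrand {β : ℝ} (hβ : 0 < β) (γ s : ℝ) {w : ℂ} (hw : 0 < w.re) :
    HasSum (fun k : ℕ => cexp (s * cexp w) * cexp ((1 - (k * β + γ) : ℝ) * w))
      (mlIntegrand β γ s w) := by
  have h1 : ‖cexp (-(β * w))‖ < 1 := by
    rw [Complex.norm_exp, Real.exp_lt_one_iff]
    simpa using mul_pos hβ hw
  have h2 := (hasSum_geometric_of_norm_lt_one h1).mul_left
    (cexp (s * cexp w) * cexp ((1 - γ : ℝ) * w))
  rw [← div_eq_mul_inv] at h2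
  refine h2.congr_fun fun k => ?_
  rw [← Complex.exp_nat_mul, mul_assoc]
  congr 1
  rw [← Complex.exp_add]
  push_cast
  ring_nf

lemma hasSum_hankelIntegral_mlIntegrand {β s : ℝ} (hβ : 0 < β) (γ : ℝ) (hs : 0 < s) :
    HasSum (fun k : ℕ => 2 * π * I * (s ^ (k * β + γ - 1) / Real.Gamma (k * β + γ) : ℝ))
      (hankelIntegral (mlIntegrand β γ s)) := by
  simp only [← hankelIntegral_exp_mul_exp hs]
  have hgeom : Summable fun k : ℕ => Real.exp (-β) ^ k :=
    summable_geometric_of_lt_one (Real.exp_pos _).le (by simpa using hβ)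
  have hexp : ∀ (k : ℕ) (x : ℝ), 1 ≤ x → Real.exp ((1 - (k * β + γ)) * x) ≤
      Real.exp ((1 - γ) * x) * Real.exp (-β) ^ k := fun k x hx => by
    rw [← Real.exp_nat_mul, ← Real.exp_add, Real.exp_le_exp]
    have : (k * β) * 1 ≤ (k * β) * x := by gcongr
    linarith
  refine HasSum.add (HasSum.mul_left _ ?_) ?_
  · refine intervalIntegral.hasSum_integral_of_dominated_convergence
      (fun k _ => Real.exp (s * Real.exp 1) * (Real.exp ((1 - γ) * 1) * Real.exp (-β) ^ k))
      (fun k => by fun_prop) (fun k => Eventually.of_forall fun y _ => ?_)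
      (Eventually.of_forall fun y _ => (hgeom.mul_left _).mul_left _) (by simp)
      (Eventually.of_forall fun y _ => hasSum_mlIntegrand hβ γ s (by simp))
    refine (norm_exp_mul_exp_le hs _ 1 y).trans ?_
    gcongr
    exact hexp k 1 le_rfl
  · refine hasSum_integral_of_dominated_convergence
      (fun k x => 2 * (Real.exp (-(s * Real.exp x)) * Real.exp ((1 - γ) * x)) *
        Real.exp (-β) ^ k)
      (fun k => by fun_prop) (fun k => ?_) (Eventually.of_forall fun x => hgeom.mul_left _) ?_ ?_
    · filter_upwards [ae_restrict_mem measurableSet_Ioi] with x hx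
      rw [exp_mul_exp_sub, norm_mul, norm_real, Real.norm_of_nonneg (by positivity)]
      have h1 : ‖2 * I * (Real.sin (π * (1 - (k * β + γ))) : ℝ)‖ ≤ 2 := by
        rw [norm_mul, norm_real]
        simpa using Real.abs_sin_le_one _
      have h2 := hexp k x (le_of_lt hx)
      calc _ ≤ 2 * (Real.exp (-(s * Real.exp x)) *
            (Real.exp ((1 - γ) * x) * Real.exp (-β) ^ k)) := by gcongr
        _ = _ := by ring
    · simp only [tsum_mul_left]
      exact ((integrableOn_exp_neg_mul_exp_mul hs _).const_mul 2).mul_const _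
    · filter_upwards [ae_restrict_mem measurableSet_Ioi] with x hx
      have hx : 0 < x := zero_lt_one.trans hx
      exact (hasSum_mlIntegrand hβ γ s (by simpa using hx)).sub
        (hasSum_mlIntegrand hβ γ s (by simpa using hx))

lemma one_sub_exp_ne_zero {β : ℝ} (hβ : 0 < β) (hβ2 : β < 2) {w : ℂ} (hw : |w.im| ≤ π)
    (h0 : w ≠ 0) : 1 - cexp (-(β * w)) ≠ 0 := by
  intro h
  obtain ⟨n, hn⟩ := Complex.exp_eq_one_iff.1 (sub_eq_zero.1 h).symm
  have hre : w.re = 0 := by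
    have := congrArg Complex.re hn
    simpa [hβ.ne'] using this
  have him : -(β * w.im) = n * (2 * π) := by
    have := congrArg Complex.im hn
    simpa using this
  have hw0 : w.im ≠ 0 := fun h => h0 (Complex.ext hre h)
  have hn0 : n ≠ 0 := by
    rintro rfl
    simp [hβ.ne', hw0] at him
  have h1 : (1 : ℝ) ≤ |(n : ℝ)| := by exact_mod_cast Int.one_le_abs hn0
  have h2 : β * |w.im| = |(n : ℝ)| * (2 * π) := by
    have := congrArg abs him
    rwa [abs_neg, abs_mul, abs_mul, abs_of_pos hβ, abs_of_pos Real.two_pi_pos] at this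
  nlinarith [Real.pi_pos, mul_le_mul h1 le_rfl Real.two_pi_pos.le (abs_nonneg _),
    mul_le_mul_of_nonneg_left hw hβ.le]

lemma integral_inv_one_sub_exp :
    ∫ y in (-π)..π, (1 - cexp (-(((1 : ℝ) : ℂ) + y * I)))⁻¹ = 2 * π := by
  have h := circleIntegral.integral_sub_inv_of_mem_ball (c := 0) (w := 1) (R := Real.exp 1)
    (by simp)
  rw [circleIntegral] at h
  have h1 : ∀ θ : ℝ, deriv (circleMap 0 (Real.exp 1)) θ • (circleMap 0 (Real.exp 1) θ - 1)⁻¹ =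
      (1 - cexp (-(((1 : ℝ) : ℂ) + θ * I)))⁻¹ * I := fun θ => by
    have h2 : circleMap 0 (Real.exp 1) θ = cexp (((1 : ℝ) : ℂ) + θ * I) := by
      rw [circleMap_zero, Complex.exp_add]; simp
    rw [deriv_circleMap, h2, Complex.exp_neg, smul_eq_mul]
    have h3 := Complex.exp_ne_zero (((1 : ℝ) : ℂ) + θ * I)
    generalize cexp (((1 : ℝ) : ℂ) + θ * I) = z at h3
    rw [show 1 - z⁻¹ = (z - 1) / z by field_simp, inv_div]
    ring
  simp only [h1, intervalIntegral.integral_mul_const] at h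
  have h2 := mul_right_cancel₀ I_ne_zero h
  have hp : Function.Periodic (fun y : ℝ => (1 - cexp (-(((1 : ℝ) : ℂ) + y * I)))⁻¹) (2 * π) := by
    intro y
    simp only
    congr 2
    rw [show -(((1 : ℝ) : ℂ) + (y + 2 * π : ℝ) * I) = -(((1 : ℝ) : ℂ) + y * I) - 2 * π * I by
      push_cast; ring]
    exact Complex.exp_periodic.sub_eq _
  have h3 := hp.intervalIntegral_add_eq (-π) 0
  rw [zero_add, show -π + 2 * π = π by ring, h2] at h3
  exact h3

/-- The regular part of `mlIntegrand β γ s` after its pole at the origin has been removed. -/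
noncomputable def mlRegular (β γ s : ℝ) (w : ℂ) : ℂ :=
  dslope (fun w => cexp (s * cexp w) * cexp ((1 - γ : ℝ) * w) *
      dslope (fun w => 1 - cexp (-((1 : ℝ) * w))) 0 w -
      (Real.exp s / β : ℝ) * dslope (fun w => 1 - cexp (-(β * w))) 0 w) 0 w /
    (dslope (fun w => 1 - cexp (-(β * w))) 0 w * dslope (fun w => 1 - cexp (-((1 : ℝ) * w))) 0 w)

lemma dslope_one_sub_exp_zero (β : ℝ) : dslope (fun w => 1 - cexp (-(β * w))) 0 0 = β := by
  rw [dslope_same]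
  have h : HasDerivAt (fun w : ℂ => 1 - cexp (-(β * w))) (-(cexp (-(β * 0)) * -(β * 1))) 0 :=
    ((((hasDerivAt_id (0 : ℂ)).const_mul (β : ℂ)).neg).cexp).const_sub 1
  rw [h.deriv]
  simp

lemma dslope_one_sub_exp_of_ne (β : ℝ) {w : ℂ} (hw : w ≠ 0) :
    dslope (fun w => 1 - cexp (-(β * w))) 0 w = (1 - cexp (-(β * w))) / w := by
  rw [dslope_of_ne _ hw, slope_def_field]
  simp

lemma dslope_one_sub_exp_ne_zero {β : ℝ} (hβ : 0 < β) (hβ2 : β < 2) {w : ℂ} (hw : |w.im| ≤ π) :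
    dslope (fun w => 1 - cexp (-(β * w))) 0 w ≠ 0 := by
  rcases eq_or_ne w 0 with rfl | h0
  · rw [dslope_one_sub_exp_zero]
    exact ofReal_ne_zero.2 hβ.ne'
  · rw [dslope_one_sub_exp_of_ne _ h0]
    exact div_ne_zero (one_sub_exp_ne_zero hβ hβ2 hw h0) h0

lemma differentiable_dslope {f : ℂ → ℂ} (hf : Differentiable ℂ f) (c : ℂ) :
    Differentiable ℂ (dslope f c) := by
  rw [← differentiableOn_univ] at hf ⊢
  exact (differentiableOn_dslope univ_mem).2 hf

lemma differentiableOn_mlRegular {β : ℝ} (hβ : 0 < β) (hβ2 : β < 2) (γ s : ℝ) :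
    DifferentiableOn ℂ (mlRegular β γ s) {w | |w.im| ≤ π} := by
  have hu : ∀ b : ℝ, Differentiable ℂ (dslope (fun w => 1 - cexp (-(b * w))) 0) := fun b =>
    differentiable_dslope (by fun_prop) 0
  refine DifferentiableOn.div (Differentiable.differentiableOn (differentiable_dslope ?_ 0))
    ((hu β).mul (hu 1)).differentiableOn fun w hw =>
      mul_ne_zero (dslope_one_sub_exp_ne_zero hβ hβ2 hw)
        (dslope_one_sub_exp_ne_zero one_pos one_lt_two hw)
  exact (Differentiable.mul (by fun_prop) (hu 1)).sub ((hu β).const_mul _)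

lemma mlRegular_of_ne {β : ℝ} (hβ : 0 < β) (hβ2 : β < 2) (γ s : ℝ) {w : ℂ} (hw : |w.im| ≤ π)
    (h0 : w ≠ 0) :
    mlRegular β γ s w = mlIntegrand β γ s w - (Real.exp s / β : ℝ) * (1 - cexp (-w))⁻¹ := by
  have h1 := one_sub_exp_ne_zero hβ hβ2 hw h0
  have h2 := one_sub_exp_ne_zero one_pos one_lt_two hw h0
  have hβ' := ofReal_ne_zero.2 hβ.ne'
  rw [mlRegular, dslope_of_ne _ h0, slope_def_field, dslope_one_sub_exp_of_ne _ h0,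
    dslope_one_sub_exp_of_ne _ h0, dslope_one_sub_exp_zero, dslope_one_sub_exp_zero, mlIntegrand]
  simp only [ofReal_one, one_mul] at h2 ⊢
  generalize cexp (s * cexp w) * cexp ((1 - γ : ℝ) * w) = A
  simp only [Complex.exp_zero, mul_zero, mul_one, ofReal_div, ofReal_exp]
  rw [div_mul_cancel₀ _ hβ', sub_self, sub_zero, sub_zero]
  generalize 1 - cexp (-(β * w)) = u at *
  generalize 1 - cexp (-w) = v at *
  field_simp

lemma mlIntegrand_eq (β γ s : ℝ) (w : ℂ) :
    mlIntegrand β γ s w =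
      cexp (s * cexp w) * cexp ((1 + β - γ : ℝ) * w) / (cexp (β * w) - 1) := by
  have h1 : cexp ((1 + β - γ : ℝ) * w) = cexp ((1 - γ : ℝ) * w) * cexp (β * w) := by
    rw [← Complex.exp_add]; push_cast; ring_nf
  have h2 : cexp (β * w) ≠ 0 := Complex.exp_ne_zero _
  rw [mlIntegrand, h1, Complex.exp_neg]
  generalize cexp (β * w) = u at *
  rw [show 1 - u⁻¹ = (u - 1) / u by field_simp, div_div_eq_mul_div]
  ring

/-- The jump of the contour integrand across the cut, without its exponential factors. -/
noncomputable def mlJump (β γ : ℝ) (x : ℝ) : ℂ :=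
  cexp ((1 + β - γ : ℝ) * π * I) / (cexp (β * (x + π * I)) - 1) -
    cexp (-((1 + β - γ : ℝ) * π * I)) / (cexp (β * (x - π * I)) - 1)

lemma mlIntegrand_sub (β γ s x : ℝ) :
    mlIntegrand β γ s (x + π * I) - mlIntegrand β γ s (x - π * I) =
      ((Real.exp (-(s * Real.exp x)) * Real.exp ((1 + β - γ) * x) : ℝ) : ℂ) * mlJump β γ x := by
  rw [mlIntegrand_eq, mlIntegrand_eq, exp_mul_exp_add_pi_mul_I, exp_mul_exp_sub_pi_mul_I, mlJump]
  ring

lemma abs_sin_le_norm_exp_sub_one (x y : ℝ) : |Real.sin y| ≤ ‖cexp (x + y * I) - 1‖ := by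
  have h : ‖cexp (x + y * I) - 1‖ = ‖(Real.exp x : ℂ) - cexp (-(y * I))‖ := by
    rw [← one_mul ‖(Real.exp x : ℂ) - cexp (-(y * I))‖, ← Complex.norm_exp_ofReal_mul_I y,
      ← norm_mul, mul_sub, ← Complex.exp_add, Complex.exp_add x]
    simp [mul_comm]
  rw [h]
  refine le_trans (le_of_eq ?_) (Complex.abs_im_le_norm _)
  rw [← neg_mul, ← ofReal_neg, sub_im, exp_ofReal_mul_I_im, ofReal_im]
  simp

lemma sin_mul_pi_ne_zero {β : ℝ} (h1 : 1 < β) (h2 : β < 2) : Real.sin (β * π) ≠ 0 := by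
  have h := Real.sin_pos_of_pos_of_lt_pi (x := β * π - π) (by nlinarith [Real.pi_pos])
    (by nlinarith [Real.pi_pos])
  rw [Real.sin_sub_pi] at h
  linarith

lemma abs_sin_le_norm_exp_add (β x : ℝ) :
    |Real.sin (β * π)| ≤ ‖cexp (β * (x + π * I)) - 1‖ := by
  convert abs_sin_le_norm_exp_sub_one (β * x) (β * π) using 4
  push_cast; ring

lemma abs_sin_le_norm_exp_sub (β x : ℝ) :
    |Real.sin (β * π)| ≤ ‖cexp (β * (x - π * I)) - 1‖ := by
  rw [← abs_neg, ← Real.sin_neg]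
  convert abs_sin_le_norm_exp_sub_one (β * x) (-(β * π)) using 4
  push_cast; ring

lemma continuous_mlJump {β : ℝ} (h1 : 1 < β) (h2 : β < 2) (γ : ℝ) : Continuous (mlJump β γ) := by
  have h := abs_pos.2 (sin_mul_pi_ne_zero h1 h2)
  refine (Continuous.div (by fun_prop) (by fun_prop) fun x => ?_).sub
    (Continuous.div (by fun_prop) (by fun_prop) fun x => ?_)
  · exact norm_pos_iff.1 (h.trans_le (abs_sin_le_norm_exp_add β x))
  · exact norm_pos_iff.1 (h.trans_le (abs_sin_le_norm_exp_sub β x))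

lemma norm_mlJump_le {β : ℝ} (h1 : 1 < β) (h2 : β < 2) (γ x : ℝ) :
    ‖mlJump β γ x‖ ≤ 1 / |Real.sin (β * π)| + 1 / |Real.sin (β * π)| := by
  have h := abs_pos.2 (sin_mul_pi_ne_zero h1 h2)
  refine (norm_sub_le _ _).trans (add_le_add ?_ ?_)
  · rw [norm_div, ← ofReal_mul, norm_exp_ofReal_mul_I]
    exact one_div_le_one_div_of_le h (abs_sin_le_norm_exp_add β x)
  · rw [norm_div, ← ofReal_mul, ← neg_mul, ← ofReal_neg, norm_exp_ofReal_mul_I]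
    exact one_div_le_one_div_of_le h (abs_sin_le_norm_exp_sub β x)

lemma tendsto_mlJump {β : ℝ} (hβ : 0 < β) (γ : ℝ) :
    Tendsto (mlJump β γ) atBot (𝓝 (-(2 * I * (Real.sin (π * (1 + β - γ)) : ℝ)))) := by
  have h : ∀ c : ℂ, c.re = 0 → Tendsto (fun x : ℝ => cexp (β * (x + c)) - 1) atBot
      (𝓝 (0 - 1)) := by
    intro c hc
    refine Tendsto.sub_const (squeeze_zero_norm (a := fun x => Real.exp (β * x)) (fun x => ?_) ?_) 1
    · rw [Complex.norm_exp]; simp [hc]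
    · exact Real.tendsto_exp_atBot.comp (tendsto_id.const_mul_atBot hβ)
  have h1 := (tendsto_const_nhds (x := cexp ((1 + β - γ : ℝ) * π * I))).div
    (h (π * I) (by simp)) (by simp)
  have h2 := (tendsto_const_nhds (x := cexp (-((1 + β - γ : ℝ) * π * I)))).div
    (h (-(π * I)) (by simp)) (by simp)
  have h3 := h1.sub h2
  rw [← exp_mul_I_sub_exp_neg_mul_I]
  simp only [← sub_eq_add_neg] at h3
  have hval : ∀ z w : ℂ, z / (0 - 1) - w / (0 - 1) = -(z - w) := fun z w => by ring
  rw [hval] at h3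
  exact h3

/-- Watson's lemma in exponential coordinates. -/
lemma tendsto_rpow_mul_integral {a M : ℝ} {K : ℝ → ℂ} {L : ℂ} (ha : 0 < a) (hK : Continuous K)
    (hM : ∀ x, ‖K x‖ ≤ M) (hL : Tendsto K atBot (𝓝 L)) :
    Tendsto (fun s : ℝ => ((s ^ a : ℝ) : ℂ) *
      ∫ x : ℝ, ((Real.exp (-(s * Real.exp x)) * Real.exp (a * x) : ℝ) : ℂ) * K x) atTop
      (𝓝 (Real.Gamma a * L)) := by
  have hg := integrable_exp_neg_mul_exp_mul one_pos ha
  have h1 : ∀ᶠ s : ℝ in atTop,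
      ∫ x : ℝ, ((Real.exp (-(1 * Real.exp x)) * Real.exp (a * x) : ℝ) : ℂ) * K (x - Real.log s) =
        ((s ^ a : ℝ) : ℂ) *
          ∫ x : ℝ, ((Real.exp (-(s * Real.exp x)) * Real.exp (a * x) : ℝ) : ℂ) * K x := by
    filter_upwards [eventually_gt_atTop 0] with s hs
    rw [← integral_sub_right_eq_self (fun x : ℝ => ((Real.exp (-(s * Real.exp x)) *
      Real.exp (a * x) : ℝ) : ℂ) * K x) (Real.log s), ← integral_const_mul]
    congr 1 with x
    have h2 : s * Real.exp (x - Real.log s) = 1 * Real.exp x := by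
      rw [Real.exp_sub, Real.exp_log hs]; field_simp
    have h3 : Real.exp (a * x) = s ^ a * Real.exp (a * (x - Real.log s)) := by
      rw [Real.rpow_def_of_pos hs, ← Real.exp_add]; ring_nf
    rw [h2, h3]
    push_cast
    ring
  have h4 : (Real.Gamma a : ℂ) * L =
      ∫ x : ℝ, ((Real.exp (-(1 * Real.exp x)) * Real.exp (a * x) : ℝ) : ℂ) * L := by
    rw [integral_mul_const, integral_complex_ofReal, integral_exp_neg_mul_exp_mul one_pos ha]
    simp
  rw [h4]
  refine Tendsto.congr' h1 (tendsto_integral_filter_of_dominated_convergence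
    (fun x => Real.exp (-(1 * Real.exp x)) * Real.exp (a * x) * M)
    (Eventually.of_forall fun s => ?_) (Eventually.of_forall fun s => ?_) (hg.mul_const M) ?_)
  · exact Continuous.aestronglyMeasurable (by fun_prop)
  · refine Eventually.of_forall fun x => ?_
    rw [norm_mul, norm_real, Real.norm_of_nonneg (by positivity)]
    gcongr
    exact hM _
  · refine Eventually.of_forall fun x => Tendsto.const_mul _ (hL.comp ?_)
    exact tendsto_atBot_add_const_left _ x (tendsto_neg_atTop_atBot.comp Real.tendsto_log_atTop)

lemma norm_one_sub_exp_ge (β x y : ℝ) :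
    Real.exp (-(β * x)) - 1 ≤ ‖1 - cexp (-(β * (x + y * I)))‖ := by
  rw [norm_sub_rev, ← norm_exp_neg_mul β x y]
  simpa using norm_sub_norm_le (cexp (-(β * (x + y * I)))) 1

lemma tendsto_exp_div_exp_sub_one {a β : ℝ} (hβ : 0 < β) (ha : 0 < a + β) :
    Tendsto (fun x : ℝ => Real.exp (a * x) / (Real.exp (-(β * x)) - 1)) atBot (𝓝 0) := by
  have h0 : ∀ c : ℝ, 0 < c → Tendsto (fun x : ℝ => Real.exp (c * x)) atBot (𝓝 0) := fun c hc =>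
    Real.tendsto_exp_atBot.comp (tendsto_id.const_mul_atBot hc)
  have h1 := (h0 _ ha).div ((h0 β hβ).const_sub 1) (by simp)
  simp only [zero_div] at h1
  refine h1.congr fun x => ?_
  simp only [Pi.div_apply]
  rw [add_mul, Real.exp_add, Real.exp_neg]
  have := Real.exp_pos (β * x)
  generalize Real.exp (β * x) = u at *
  rw [show u⁻¹ - 1 = (1 - u) / u by field_simp, div_div_eq_mul_div]

lemma hankelIntegral_mlIntegrand {β γ s : ℝ} (h1 : 1 < β) (h2 : β < 2) (hγ : γ < 1 + β)
    (hs : 0 < s) :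
    hankelIntegral (mlIntegrand β γ s) = 2 * π * I * (Real.exp s / β : ℝ) +
      ∫ x : ℝ, ((Real.exp (-(s * Real.exp x)) * Real.exp ((1 + β - γ) * x) : ℝ) : ℂ) *
        mlJump β γ x := by
  have hβ : 0 < β := by linarith
  have hne : ∀ x y : ℝ, x ≠ 0 → (x : ℂ) + y * I ≠ 0 := fun x y hx h =>
    hx (by simpa using congrArg Complex.re h)
  have hπ : |π| ≤ π := (abs_of_pos Real.pi_pos).le
  have hjump : ∀ x : ℝ, mlRegular β γ s (x + π * I) - mlRegular β γ s (x - π * I) =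
      ((Real.exp (-(s * Real.exp x)) * Real.exp ((1 + β - γ) * x) : ℝ) : ℂ) * mlJump β γ x := by
    intro x
    rw [← mlIntegrand_sub, mlRegular_of_ne hβ h2 γ s (by simpa using hπ)
      (fun h => Real.pi_ne_zero (by simpa using congrArg Complex.im h)),
      mlRegular_of_ne hβ h2 γ s (by simpa using hπ)
      (fun h => Real.pi_ne_zero (by simpa using congrArg Complex.im h))]
    simp only [Complex.exp_neg, exp_add_pi_mul_I_ofReal, exp_sub_pi_mul_I_ofReal]
    ring
  have hint : ∀ x : ℝ, x ≠ 0 → ∀ y ∈ uIcc (-π) π, mlRegular β γ s (x + y * I) =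
      mlIntegrand β γ s (x + y * I) - (Real.exp s / β : ℝ) * (1 - cexp (-(x + y * I)))⁻¹ := by
    intro x hx y hy
    rw [uIcc_of_le (neg_le_self Real.pi_pos.le)] at hy
    exact mlRegular_of_ne hβ h2 γ s (by simpa using abs_le.2 hy) (hne x y hx)
  have hreg := hankelIntegral_eq_of_tendsto (L := 0) (differentiableOn_mlRegular hβ h2 γ s) ?_ ?_
  · rw [mul_zero, zero_add] at hreg
    simp only [hjump] at hreg
    rw [← hreg, hankelIntegral, hankelIntegral,
      intervalIntegral.integral_congr (hint 1 one_ne_zero), intervalIntegral.integral_sub,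
      intervalIntegral.integral_const_mul, integral_inv_one_sub_exp]
    · simp only [hjump, mlIntegrand_sub]
      ring
    · refine ContinuousOn.intervalIntegrable fun y hy => ContinuousAt.continuousWithinAt ?_
      rw [uIcc_of_le (neg_le_self Real.pi_pos.le)] at hy
      have := one_sub_exp_ne_zero hβ h2 (w := ((1 : ℝ) : ℂ) + y * I) (by simpa using abs_le.2 hy)
        (hne 1 y one_ne_zero)
      unfold mlIntegrand
      fun_prop (disch := assumption)
    · refine ContinuousOn.intervalIntegrable fun y hy => ContinuousAt.continuousWithinAt ?_
      rw [uIcc_of_le (neg_le_self Real.pi_pos.le)] at hy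
      have := one_sub_exp_ne_zero one_pos one_lt_two (w := ((1 : ℝ) : ℂ) + y * I)
        (by simpa using abs_le.2 hy) (hne 1 y one_ne_zero)
      rw [ofReal_one, one_mul, ← ofReal_one] at this
      fun_prop (disch := assumption)
  · simp only [hjump]
    exact (integrable_exp_neg_mul_exp_mul hs (by linarith)).ofReal.mul_bdd
      (continuous_mlJump h1 h2 γ).aestronglyMeasurable
      (Eventually.of_forall (norm_mlJump_le h1 h2 γ))
  · have hlim : Tendsto (fun x : ℝ => (Real.exp (s * Real.exp x) *
        (Real.exp ((1 - γ) * x) / (Real.exp (-(β * x)) - 1)) +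
        Real.exp s / β * (Real.exp (0 * x) / (Real.exp (-(1 * x)) - 1))) * |π - -π|) atBot
        (𝓝 ((Real.exp (s * 0) * 0 + Real.exp s / β * 0) * |π - -π|)) := by
      refine (((Real.tendsto_exp_atBot.const_mul s).rexp.mul ?_).add
        (Tendsto.const_mul _ ?_)).mul_const _
      · exact tendsto_exp_div_exp_sub_one hβ (by linarith)
      · exact tendsto_exp_div_exp_sub_one one_pos (by simp)
    rw [mul_zero, mul_zero, add_zero, zero_mul] at hlim
    refine squeeze_zero_norm' ?_ hlim
    filter_upwards [eventually_lt_atBot 0] with x hx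
    refine intervalIntegral.norm_integral_le_of_norm_le_const fun y hy => ?_
    rw [hint x hx.ne y (uIoc_subset_uIcc hy)]
    have hpos : ∀ b : ℝ, 0 < b → 0 < Real.exp (-(b * x)) - 1 := fun b hb => by
      rw [sub_pos, Real.one_lt_exp_iff]
      nlinarith
    refine (norm_sub_le _ _).trans (add_le_add ?_ ?_)
    · rw [mlIntegrand, norm_div, ← mul_div_assoc]
      exact div_le_div₀ (by positivity) (norm_exp_mul_exp_le hs _ x y) (hpos β hβ)
        (norm_one_sub_exp_ge β x y)
    · rw [norm_mul, norm_inv, norm_real, Real.norm_of_nonneg (by positivity), zero_mul,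
        Real.exp_zero, one_div]
      gcongr
      · exact hpos 1 one_pos
      · simpa using norm_one_sub_exp_ge 1 x y

/-- Asymptotics of the two-parameter Mittag-Leffler function on the positive real axis. -/
theorem tendsto_mlR_sub {β γ : ℝ} (h1 : 1 < β) (h2 : β < 2) (hγ : γ < 1 + β) :
    Tendsto (fun s : ℝ => s ^ (1 + β - γ) * (s ^ (γ - 1) * mlR β γ (s ^ β) - Real.exp s / β))
      atTop (𝓝 (-(1 / Real.Gamma (γ - β)))) := by
  have hβ : 0 < β := by linarith
  have ha : 0 < 1 + β - γ := by linarith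
  have hW := (tendsto_rpow_mul_integral ha (continuous_mlJump h1 h2 γ) (norm_mlJump_le h1 h2 γ)
    (tendsto_mlJump hβ γ)).const_mul (2 * π * I)⁻¹
  have hpi : (2 * π * I : ℂ) ≠ 0 := by simp [Real.pi_ne_zero]
  have hlim : (2 * π * I : ℂ)⁻¹ * (Real.Gamma (1 + β - γ) *
      -(2 * I * (Real.sin (π * (1 + β - γ)) : ℝ))) = (-(1 / Real.Gamma (γ - β)) : ℝ) := by
    have h := sin_mul_Gamma_one_sub (γ := γ - β) (by linarith)
    rw [show 1 - (γ - β) = 1 + β - γ by ring] at h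
    have h' : ((Real.sin (π * (1 + β - γ)) : ℝ) : ℂ) * (Real.Gamma (1 + β - γ) : ℝ) =
      π * (1 / Real.Gamma (γ - β) : ℝ) := by exact_mod_cast h
    rw [inv_mul_eq_iff_eq_mul₀ hpi, ofReal_neg]
    linear_combination -2 * I * h'
  rw [hlim] at hW
  rw [← tendsto_ofReal_iff]
  refine hW.congr' ?_
  filter_upwards [eventually_gt_atTop 0] with s hs
  have hsum := (hasSum_hankelIntegral_mlIntegrand hβ γ hs).mul_left (2 * π * I)⁻¹
  simp only [inv_mul_cancel_left₀ hpi] at hsum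
  have hml : s ^ (γ - 1) * mlR β γ (s ^ β) =
      ∑' k : ℕ, s ^ (k * β + γ - 1) / Real.Gamma (k * β + γ) := by
    rw [mlR, ← tsum_mul_left]
    congr 1 with k
    rw [← Real.rpow_natCast, ← Real.rpow_mul hs.le, ← mul_div_assoc, ← Real.rpow_add hs]
    ring_nf
  have hcast : ((s ^ (γ - 1) * mlR β γ (s ^ β) : ℝ) : ℂ) =
      (2 * π * I)⁻¹ * hankelIntegral (mlIntegrand β γ s) := by
    rw [hml, ofReal_tsum, hsum.tsum_eq]
  rw [ofReal_mul, ofReal_sub, hcast, hankelIntegral_mlIntegrand h1 h2 hγ hs, mul_add,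
    inv_mul_cancel_left₀ hpi]
  ring

lemma tendsto_mlR_sq_sub {β : ℝ} (h1 : 1 < β) (h2 : β < 2) :
    Tendsto (fun s : ℝ => (mlR β 1 (s ^ β) ^ 2 - mlR β 0 (s ^ β) * mlR β 2 (s ^ β)) *
      s ^ (β - 1) * Real.exp (-s)) atTop (𝓝 (1 / (β * Real.Gamma (2 - β)))) := by
  have hβ : β ≠ 0 := by linarith
  have hr0 := tendsto_mlR_sub (γ := 0) h1 h2 (by linarith)
  have hr1 := tendsto_mlR_sub (γ := 1) h1 h2 (by linarith)
  have hr2 := tendsto_mlR_sub (γ := 2) h1 h2 (by linarith)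
  have hinv := tendsto_inv_atTop_zero (𝕜 := ℝ)
  have hexp : Tendsto (fun s : ℝ => s ^ (-β - 1) * Real.exp (-1 * s)) atTop (𝓝 0) :=
    tendsto_rpow_mul_exp_neg_mul_atTop_nhds_zero _ 1 one_pos
  have hlim := ((((hinv.mul hr1).const_mul 2).sub hr2).sub ((hinv.pow 2).mul hr0)).const_mul (1 / β)
    |>.add (hexp.mul ((hr1.pow 2).sub (hr0.mul hr2)))
  have hval : 1 / β * (2 * (0 * -(1 / Real.Gamma (1 - β))) - -(1 / Real.Gamma (2 - β)) -
      0 ^ 2 * -(1 / Real.Gamma (0 - β))) + 0 * ((-(1 / Real.Gamma (1 - β))) ^ 2 -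
        -(1 / Real.Gamma (0 - β)) * -(1 / Real.Gamma (2 - β))) =
      1 / (β * Real.Gamma (2 - β)) := by
    rw [← one_div_mul_one_div]
    ring
  rw [hval] at hlim
  refine hlim.congr' ?_
  filter_upwards [eventually_gt_atTop 0] with s hs
  have hx : Real.exp (-s) = (Real.exp s)⁻¹ := Real.exp_neg s
  rw [neg_one_mul, hx, show 1 + β - 0 = 1 + β by ring, show 1 + β - 1 = β by ring,
    show 1 + β - 2 = β - 1 by ring, show (0 : ℝ) - 1 = -1 by ring, show (1 : ℝ) - 1 = 0 by ring,
    show (2 : ℝ) - 1 = 1 by ring, Real.rpow_add hs, Real.rpow_sub hs, Real.rpow_sub hs,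
    Real.rpow_neg hs.le, Real.rpow_neg hs.le, Real.rpow_one, Real.rpow_zero]
  have hb := (Real.rpow_pos_of_pos hs β).ne'
  have he := (Real.exp_pos s).ne'
  generalize mlR β 0 (s ^ β) = E0
  generalize mlR β 1 (s ^ β) = E1
  generalize mlR β 2 (s ^ β) = E2
  generalize s ^ β = b at *
  generalize Real.exp s = e at *
  field_simp
  ring

/-- Asymptotics of `E_{β,1}(t)² − E_{β,0}(t) E_{β,2}(t)` on the positive real axis:
the leading `e^{2t^{1/β}}` terms cancel, leaving growth of order `t^{1/β−1} e^{t^{1/β}}`. -/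
theorem stmt_16 (β : ℝ) (hβ : β ∈ Set.Ioo (1:ℝ) 2) :
    Filter.Tendsto
      (fun t : ℝ => (mlR β 1 t ^ 2 - mlR β 0 t * mlR β 2 t) *
        t ^ (1 - 1/β) * Real.exp (-(t ^ (1/β))))
      Filter.atTop (nhds (1 / (β * Real.Gamma (2 - β)))) := by
  obtain ⟨h1, h2⟩ := hβ
  have hβ : β ≠ 0 := by linarith
  have h := (tendsto_mlR_sq_sub h1 h2).comp (tendsto_rpow_atTop (one_div_pos.2 (by linarith : 0 < β)))
  refine h.congr' ?_
  filter_upwards [eventually_gt_atTop 0] with t ht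
  simp only [Function.comp]
  rw [← Real.rpow_mul ht.le, ← Real.rpow_mul ht.le, one_div_mul_cancel hβ, Real.rpow_one,
    show 1 / β * (β - 1) = 1 - 1 / β by field_simp]
end
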